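/- arXiv:2512.14519 — 2 statements merged into one kernel-verified Lean document; each statement's English description precedes it below -/
import Mathlib

section
/- Let R be a commutative ring with identity and S a multiplicatively closed subset of R such that the nilradical Nil(R) is S-decomposable. If R is nonnil-S-Laskerian, then R/Nil(R) is an S̄-Laskerian ring, where S̄ = {s + Nil(R) : s ∈ S} is the image of S in R/Nil(R). -/
variable {R : Type*}

/-- A proper ideal `Q` disjoint from `S` is `S`-primary if there is `s ∈ S` such that
for all `a b`, `a * b ∈ Q` implies `s * a ∈ Q` or `s * b ∈ Q.radical`. -/
def IsSPrimary [CommRing R] (S : Submonoid R) (Q : Ideal R) : Prop :=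
  Q ≠ ⊤ ∧ Disjoint (S : Set R) (Q : Set R) ∧
    ∃ s ∈ S, ∀ a b : R, a * b ∈ Q → s * a ∈ Q ∨ s * b ∈ Q.radical

/-- An ideal is `S`-decomposable if it is a finite intersection of `S`-primary ideals. -/
def IsSDecomposable [CommRing R] (S : Submonoid R) (I : Ideal R) : Prop :=
  ∃ (n : ℕ) (Q : Fin n → Ideal R), 0 < n ∧ (∀ i, IsSPrimary S (Q i)) ∧ I = ⨅ i, Q i

/-- A ring is nonnil-`S`-Laskerian if every nonnil ideal disjoint from `S`
is `S`-decomposable. -/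
def NonnilSLaskerian [CommRing R] (S : Submonoid R) : Prop :=
  ∀ I : Ideal R, ¬ I ≤ nilradical R → Disjoint (S : Set R) (I : Set R) →
    IsSDecomposable S I

/-- A ring is `S`-Laskerian if every proper ideal disjoint from `S` is `S`-decomposable. -/
def SLaskerian [CommRing R] (S : Submonoid R) : Prop :=
  ∀ I : Ideal R, I ≠ ⊤ → Disjoint (S : Set R) (I : Set R) → IsSDecomposable S I

/-- An ideal `I` is `S`-finite if `s • I ⊆ J ⊆ I` for some `s ∈ S` and finitely
generated ideal `J`. -/
def IsSFinite [CommRing R] (S : Submonoid R) (I : Ideal R) : Prop :=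
  ∃ s ∈ S, ∃ J : Ideal R, J.FG ∧ J ≤ I ∧ ∀ x ∈ I, s * x ∈ J

/-- A ring is nonnil-`S`-Noetherian if every nonnil ideal is `S`-finite. -/
def NonnilSNoetherian [CommRing R] (S : Submonoid R) : Prop :=
  ∀ I : Ideal R, ¬ I ≤ nilradical R → IsSFinite S I

theorem Ideal.apply_mem_map_iff_of_ker_le {R A : Type*} [CommRing R] [CommRing A] {f : R →+* A}
    (hf : Function.Surjective f) {Q : Ideal R} (hQ : RingHom.ker f ≤ Q) {x : R} :
    f x ∈ Q.map f ↔ x ∈ Q := by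
  rw [← Ideal.mem_comap, Ideal.comap_map_of_surjective' f hf, sup_eq_left.mpr hQ]

theorem IsSPrimary.map_of_surjective {R A : Type*} [CommRing R] [CommRing A] {f : R →+* A}
    (hf : Function.Surjective f) {S : Submonoid R} {Q : Ideal R} (hQ : IsSPrimary S Q)
    (hker : RingHom.ker f ≤ Q) : IsSPrimary (S.map f.toMonoidHom) (Q.map f) := by
  have hmem {x : R} : f x ∈ Q.map f ↔ x ∈ Q := Ideal.apply_mem_map_iff_of_ker_le hf hker
  obtain ⟨hne, hdisj, s, hs, hprim⟩ := hQ
  refine ⟨?_, ?_, f s, ⟨s, hs, rfl⟩, fun a b hab => ?_⟩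
  · rwa [Ne, Ideal.eq_top_iff_one, ← map_one f, hmem, ← Ideal.eq_top_iff_one]
  · rw [Set.disjoint_left] at hdisj ⊢
    rintro _ ⟨t, ht, rfl⟩ htQ
    exact hdisj ht (hmem.mp htQ)
  · obtain ⟨a, rfl⟩ := hf a
    obtain ⟨b, rfl⟩ := hf b
    rw [← map_mul, hmem] at hab
    refine (hprim a b hab).imp (fun ha => ?_) (fun hb => ?_)
    · rwa [← map_mul, hmem]
    · obtain ⟨n, hn⟩ := hb
      exact ⟨n, by rwa [← map_mul, ← map_pow, hmem]⟩

theorem IsSDecomposable.of_comap {R A : Type*} [CommRing R] [CommRing A] {f : R →+* A}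
    (hf : Function.Surjective f) {S : Submonoid R} {I : Ideal A}
    (hI : IsSDecomposable S (I.comap f)) : IsSDecomposable (S.map f.toMonoidHom) I := by
  obtain ⟨n, Q, hn, hQ, hIQ⟩ := hI
  have hker (i : Fin n) : RingHom.ker f ≤ Q i :=
    (Ideal.comap_mono bot_le).trans (hIQ.trans_le (iInf_le Q i))
  refine ⟨n, fun i => (Q i).map f, hn, fun i => (hQ i).map_of_surjective hf (hker i), ?_⟩
  ext x
  obtain ⟨x, rfl⟩ := hf x
  rw [← Ideal.mem_comap, hIQ]
  simp only [Ideal.mem_iInf, Ideal.apply_mem_map_iff_of_ker_le hf (hker _)]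

/-- If `R` is nonnil-`S`-Laskerian with `S`-decomposable nilradical, then
`R/Nil(R)` is `S̄`-Laskerian. -/
theorem quotient_nilradical_SLaskerian {R : Type*} [CommRing R] (S : Submonoid R)
    (hnil : IsSDecomposable S (nilradical R)) (h : NonnilSLaskerian S) :
    SLaskerian (S.map (Ideal.Quotient.mk (nilradical R)).toMonoidHom) := by
  intro I _ hI
  refine IsSDecomposable.of_comap Ideal.Quotient.mk_surjective ?_
  by_cases hle : I.comap (Ideal.Quotient.mk (nilradical R)) ≤ nilradical R
  · have hge : nilradical R ≤ I.comap (Ideal.Quotient.mk (nilradical R)) := by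
      conv_lhs => rw [← Ideal.mk_ker (I := nilradical R)]
      exact Ideal.comap_mono bot_le
    rwa [le_antisymm hle hge]
  · refine h _ hle (Set.disjoint_left.mpr fun s hs hsI => ?_)
    exact Set.disjoint_left.mp hI ⟨s, hs, rfl⟩ hsI
end

section
/- Let R be a commutative ring with identity and S a multiplicatively closed subset of R. If R is nonnil-S-Noetherian, then R is nonnil-S-Laskerian: every nonnil ideal of R disjoint from S can be written as a finite intersection of S-primary ideals. -/
variable {R : Type*}

/-- If a ring homomorphism inverts `S`, then the extension of an `S`-finite ideal is
finitely generated. -/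
theorem IsSFinite.map_fg {R A : Type*} [CommRing R] [CommRing A] {S : Submonoid R}
    {K : Ideal R} (hK : IsSFinite S K) (f : R →+* A) (hf : ∀ s ∈ S, IsUnit (f s)) :
    (K.map f).FG := by
  obtain ⟨s, hs, J, hJ, hJK, hsJ⟩ := hK
  suffices K.map f = J.map f from this ▸ hJ.map f
  refine le_antisymm (Ideal.map_le_iff_le_comap.mpr fun x hx ↦ ?_) (Ideal.map_mono hJK)
  rw [Ideal.mem_comap, ← Ideal.unit_mul_mem_iff_mem _ (hf s hs), ← map_mul]
  exact Ideal.mem_map_of_mem f (hsJ x hx)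

/-- If each element of a finitely generated ideal `J` is carried into `I` by some element of `S`,
then a single element of `S` carries all of `J` into `I`. -/
theorem Ideal.FG.exists_mul_mem {R : Type*} [CommRing R] (S : Submonoid R) {I J : Ideal R}
    (hJ : J.FG) (h : ∀ x ∈ J, ∃ s ∈ S, s * x ∈ I) : ∃ s ∈ S, ∀ x ∈ J, s * x ∈ I := by
  induction J, hJ using Submodule.fg_induction with
  | singleton a =>
    obtain ⟨s, hs, hsa⟩ := h a (Submodule.mem_span_singleton_self a)
    refine ⟨s, hs, fun x hx ↦ ?_⟩
    obtain ⟨r, rfl⟩ := Submodule.mem_span_singleton.mp hx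
    rw [smul_eq_mul, mul_left_comm]
    exact I.mul_mem_left r hsa
  | sup J₁ J₂ _ _ ih₁ ih₂ =>
    obtain ⟨s, hs, hsJ⟩ := ih₁ fun x hx ↦ h x (Submodule.mem_sup_left hx)
    obtain ⟨t, ht, htJ⟩ := ih₂ fun x hx ↦ h x (Submodule.mem_sup_right hx)
    refine ⟨s * t, S.mul_mem hs ht, fun x hx ↦ ?_⟩
    obtain ⟨y, hy, z, hz, rfl⟩ := Submodule.mem_sup.mp hx
    rw [show s * t * (y + z) = t * (s * y) + s * (t * z) by ring]
    exact I.add_mem (I.mul_mem_left t (hsJ y hy)) (I.mul_mem_left s (htJ z hz))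

/-- If every ideal containing `I` is `S`-finite, then the localization at `S` modulo the extension
of `I` is a Noetherian ring. -/
theorem isNoetherianRing_localization_quotient_map {R : Type*} [CommRing R] (S : Submonoid R)
    (I : Ideal R) (h : ∀ K : Ideal R, I ≤ K → IsSFinite S K) :
    IsNoetherianRing (Localization S ⧸ I.map (algebraMap R (Localization S))) := by
  set M := I.map (algebraMap R (Localization S))
  refine isNoetherianRing_iff_ideal_fg _ |>.mpr fun K ↦ ?_
  set L := K.comap (Ideal.Quotient.mk M)
  have hIL : I ≤ L.comap (algebraMap R (Localization S)) := by
    refine Ideal.map_le_iff_le_comap.mp fun x hx ↦ ?_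
    rw [Ideal.mem_comap, Ideal.Quotient.eq_zero_iff_mem.mpr hx]
    exact K.zero_mem
  have hL : L.FG := by
    rw [← IsLocalization.map_under S (Localization S) L]
    exact (h _ hIL).map_fg _ fun s hs ↦ IsLocalization.map_units (Localization S) ⟨s, hs⟩
  rw [← Ideal.map_comap_of_surjective _ Ideal.Quotient.mk_surjective K]
  exact hL.map _

/-- The intersection of a primary ideal `P` with `I ⊔ span {u}` is `S`-primary if `u ∈ S` and
`P` is disjoint from `S`. -/
theorem Ideal.IsPrimary.isSPrimary_inf {R : Type*} [CommRing R] {S : Submonoid R} {P : Ideal R}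
    (hP : P.IsPrimary) (hd : Disjoint (S : Set R) (P : Set R)) {u : R} (hu : u ∈ S)
    (I : Ideal R) : IsSPrimary S (P ⊓ (I ⊔ Ideal.span {u})) := by
  have hmem (x : R) (hx : x ∈ P) : u * x ∈ P ⊓ (I ⊔ Ideal.span {u}) :=
    ⟨P.mul_mem_left u hx, Ideal.mem_sup_right
      (Ideal.mul_mem_right x _ (Ideal.mem_span_singleton_self u))⟩
  rw [Ideal.isPrimary_iff] at hP
  refine ⟨fun h ↦ hP.1 (top_le_iff.mp (h ▸ inf_le_left)), hd.mono_right fun _ hx ↦ hx.1, u, hu,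
    fun a b hab ↦ (hP.2 hab.1).imp (hmem a) ?_⟩
  rintro ⟨n, hn⟩
  refine ⟨n + 1, ?_⟩
  rw [show (u * b) ^ (n + 1) = (u ^ n * b) * (u * b ^ n) by ring]
  exact Ideal.mul_mem_left _ _ (hmem _ hn)

/-- Every nonnil-`S`-Noetherian ring is nonnil-`S`-Laskerian. -/
theorem nonnilSNoetherian_imp_nonnilSLaskerian {R : Type*} [CommRing R]
    (S : Submonoid R) (h : NonnilSNoetherian S) : NonnilSLaskerian S := by
  intro I hI hd
  have hfin (K : Ideal R) (hK : I ≤ K) : IsSFinite S K := h K fun hn ↦ hI (hK.trans hn)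
  set M := I.map (algebraMap R (Localization S)) with hM
  have := isNoetherianRing_localization_quotient_map S I hfin
  set f : R →+* Localization S ⧸ M := (Ideal.Quotient.mk M).comp (algebraMap R (Localization S))
  have hfS (s : R) (hs : s ∈ S) : IsUnit (f s) :=
    (IsLocalization.map_units (Localization S) ⟨s, hs⟩).map (Ideal.Quotient.mk M)
  have hker (x : R) : f x = 0 ↔ ∃ s ∈ S, s * x ∈ I := by
    rw [RingHom.comp_apply, Ideal.Quotient.eq_zero_iff_mem, hM,
      IsLocalization.algebraMap_mem_map_algebraMap_iff S]
  obtain ⟨u, hu, huI⟩ : ∃ u ∈ S, ∀ x, f x = 0 → u * x ∈ I := by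
    obtain ⟨s, hs, J, hJ, hJK, hsJ⟩ := hfin (RingHom.ker f) fun x hx ↦
      (hker x).mpr ⟨1, S.one_mem, by rwa [one_mul]⟩
    obtain ⟨t, ht, htJ⟩ := hJ.exists_mul_mem S fun x hx ↦ (hker x).mp (hJK hx)
    refine ⟨t * s, S.mul_mem ht hs, fun x hx ↦ ?_⟩
    rw [mul_assoc]
    exact htJ _ (hsJ x hx)
  obtain ⟨T, hT, hTP⟩ := Submodule.isLasker (Localization S ⧸ M) (Localization S ⧸ M) ⊥
  have hmem (x : R) : f x = 0 ↔ ∀ q ∈ T, x ∈ Ideal.comap f q := by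
    rw [← Submodule.mem_bot (Localization S ⧸ M), ← hT]
    simp [Submodule.mem_finsetInf]
  have hT₀ : T.Nonempty := by
    rw [Finset.nonempty_iff_ne_empty]
    rintro rfl
    exact Set.disjoint_left.mp hd hu (by simpa using huI 1 ((hmem 1).mpr (by simp)))
  refine ⟨T.card, fun i ↦ Ideal.comap f (T.equivFin.symm i : Ideal (Localization S ⧸ M)) ⊓
    (I ⊔ Ideal.span {u}), hT₀.card_pos, fun i ↦ ?_, ?_⟩
  · have hq : Ideal.IsPrimary (T.equivFin.symm i : Ideal (Localization S ⧸ M)) :=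
      hTP (T.equivFin.symm i).2
    refine (Ideal.IsPrimary.comap hq f).isSPrimary_inf
      (Set.disjoint_left.mpr fun s hs hsq ↦ ?_) hu I
    exact (Ideal.isPrimary_iff.mp hq).1 (Ideal.eq_top_of_isUnit_mem _ hsq (hfS s hs))
  · refine le_antisymm (le_iInf fun i ↦ le_inf (fun x hx ↦ ?_) le_sup_left) fun x hx ↦ ?_
    · exact (hmem x).mp ((hker x).mpr ⟨1, S.one_mem, by rwa [one_mul]⟩) _
        (T.equivFin.symm i).2
    rw [Ideal.mem_iInf] at hx
    have hx₀ : f x = 0 := (hmem x).mpr fun q hq ↦ by simpa using (hx (T.equivFin ⟨q, hq⟩)).1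
    obtain ⟨y, hy, z, hz, rfl⟩ := Submodule.mem_sup.mp (hx ⟨0, hT₀.card_pos⟩).2
    obtain ⟨r, rfl⟩ := Ideal.mem_span_singleton.mp hz
    have hur : u * (u * r) ∈ I := by
      have hxI := huI _ hx₀
      rw [mul_add] at hxI
      exact (I.add_mem_iff_right (I.mul_mem_left u hy)).mp hxI
    refine I.add_mem hy (huI r ((hker r).mpr ⟨u * u, S.mul_mem hu hu, ?_⟩))
    rwa [mul_assoc]
end
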